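/- Let f = (x+y)² − (x−y)⁵ and g = x in ℚ[x,y]. For every b ∈ ℚ[s], b satisfies the Bernstein–Sato functional equation for the pair (f, g) if and only if (s + 9/10)(s + 1)(s + 11/10)(s + 13/10)(s + 17/10) divides b in ℚ[s]; that is, b_{f,x}(s) = (s + 9/10)(s + 1)(s + 11/10)(s + 13/10)(s + 17/10). -/

import Mathlib

open MvPolynomial Polynomial

/-- The iterated formal partial derivative `∂^α = ∏ᵢ ∂_{xᵢ}^{αᵢ}` applied to a
multivariate polynomial (the partial derivatives pairwise commute, so the order
of the fold is immaterial). -/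
noncomputable def pdIter {σ : Type*} [Fintype σ] (α : σ → ℕ)
    (p : MvPolynomial σ ℚ) : MvPolynomial σ ℚ :=
  Finset.univ.toList.foldl (fun q i => (⇑(MvPolynomial.pderiv i))^[α i] q) p

/-- `b ∈ ℚ[s]` satisfies the Bernstein–Sato functional equation for the pair
`(f, g)`: there are finitely many multi-indices `α` and polynomials
`p_α ∈ (ℚ[x])[s]` with `b(m)·g·f^m = Σ_α p_α(m)·∂^α(g·f^(m+1))` for all `m ∈ ℕ`. -/
def SatisfiesBS {σ : Type*} [Fintype σ] (f g : MvPolynomial σ ℚ)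
    (b : Polynomial ℚ) : Prop :=
  ∃ (A : Finset (σ → ℕ)) (p : (σ → ℕ) → Polynomial (MvPolynomial σ ℚ)),
    ∀ m : ℕ,
      MvPolynomial.C (Polynomial.eval (m : ℚ) b) * g * f ^ m =
        ∑ α ∈ A, Polynomial.eval ((m : ℕ) : MvPolynomial σ ℚ) (p α) *
          pdIter α (g * f ^ (m + 1))

namespace BernsteinSato

section General

variable {σ : Type*}

theorem pderiv_pderiv_comm (i j : σ) (p : MvPolynomial σ ℚ) :
    MvPolynomial.pderiv i (MvPolynomial.pderiv j p) =
      MvPolynomial.pderiv j (MvPolynomial.pderiv i p) := by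
  classical
  have h : ⁅(MvPolynomial.pderiv i : Derivation ℚ (MvPolynomial σ ℚ) (MvPolynomial σ ℚ)),
      (MvPolynomial.pderiv j : Derivation ℚ (MvPolynomial σ ℚ) (MvPolynomial σ ℚ))⁆ = 0 := by
    refine MvPolynomial.derivation_ext fun k => ?_
    simp only [Derivation.commutator_apply, MvPolynomial.pderiv_X, Pi.single_apply]
    split_ifs <;> simp
  have h' := congrArg (fun D => D p) h
  simpa [Derivation.commutator_apply, sub_eq_zero] using h'

theorem iterate_pderiv_comm (i j : σ) (n : ℕ) (p : MvPolynomial σ ℚ) :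
    (⇑(MvPolynomial.pderiv j))^[n] (MvPolynomial.pderiv i p) =
      MvPolynomial.pderiv i ((⇑(MvPolynomial.pderiv j))^[n] p) :=
  by
  induction n with
  | zero => rfl
  | succ n ih => simp only [Function.iterate_succ_apply', ih, pderiv_pderiv_comm j i]

theorem foldl_pderiv_comm (α : σ → ℕ) (i : σ) (l : List σ) (p : MvPolynomial σ ℚ) :
    l.foldl (fun q j => (⇑(MvPolynomial.pderiv j))^[α j] q) (MvPolynomial.pderiv i p) =
      MvPolynomial.pderiv i (l.foldl (fun q j => (⇑(MvPolynomial.pderiv j))^[α j] q) p) := by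
  induction l generalizing p with
  | nil => rfl
  | cons j l ih => simp only [List.foldl_cons, iterate_pderiv_comm, ih]

theorem foldl_pderiv_add_single [DecidableEq σ] (α : σ → ℕ) (i : σ) (l : List σ) (hl : l.Nodup)
    (p : MvPolynomial σ ℚ) :
    l.foldl (fun q j => (⇑(MvPolynomial.pderiv j))^[(α + Pi.single i 1 : σ → ℕ) j] q) p =
      if i ∈ l then
        MvPolynomial.pderiv i (l.foldl (fun q j => (⇑(MvPolynomial.pderiv j))^[α j] q) p)
      else l.foldl (fun q j => (⇑(MvPolynomial.pderiv j))^[α j] q) p := by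
  induction l generalizing p with
  | nil => simp
  | cons j l ih =>
    have hl' := List.nodup_cons.1 hl
    simp only [List.foldl_cons, ih hl'.2, List.mem_cons]
    by_cases hij : i = j
    · subst hij
      simp only [hl'.1, if_false, true_or, if_true, Pi.add_apply, Pi.single_eq_same,
        Function.iterate_succ_apply', foldl_pderiv_comm]
    · simp [hij]

theorem pdIter_add_single [Fintype σ] [DecidableEq σ] (α : σ → ℕ) (i : σ)
    (p : MvPolynomial σ ℚ) :
    pdIter (α + Pi.single i 1) p = MvPolynomial.pderiv i (pdIter α p) := by
  rw [pdIter, foldl_pderiv_add_single _ _ _ (Finset.nodup_toList _), if_pos (by simp), pdIter]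

theorem exists_eval_derivation (D : Derivation ℚ (MvPolynomial σ ℚ) (MvPolynomial σ ℚ))
    (c : Polynomial (MvPolynomial σ ℚ)) :
    ∃ d : Polynomial (MvPolynomial σ ℚ), ∀ r : ℚ,
      D (c.eval (MvPolynomial.C r)) = d.eval (MvPolynomial.C r) := by
  induction c using Polynomial.induction_on' with
  | add p q hp hq =>
    obtain ⟨p', hp⟩ := hp
    obtain ⟨q', hq⟩ := hq
    exact ⟨p' + q', fun r => by simp [hp, hq]⟩
  | monomial n a =>
    refine ⟨Polynomial.monomial n (D a), fun r => ?_⟩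
    have h : D (MvPolynomial.C r) = 0 := D.map_algebraMap r
    simp [Derivation.leibniz, Derivation.leibniz_pow, h, mul_comm]

theorem C_eval_eq (b : Polynomial ℚ) (r : ℚ) :
    (MvPolynomial.C (b.eval r) : MvPolynomial σ ℚ) =
      (b.map MvPolynomial.C).eval (MvPolynomial.C r) := by
  rw [Polynomial.eval_map, Polynomial.eval₂_at_apply]

/-- The sequences `m ↦ (P(s) • g f^(s+1))|_{s = m}` with `P` in `D[s]`. -/
inductive DGen (f g : MvPolynomial σ ℚ) : (ℕ → MvPolynomial σ ℚ) → Prop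
  | base : DGen f g (fun m => g * f ^ (m + 1))
  | add {φ ψ : ℕ → MvPolynomial σ ℚ} (hφ : DGen f g φ) (hψ : DGen f g ψ) :
      DGen f g (fun m => φ m + ψ m)
  | mul {φ : ℕ → MvPolynomial σ ℚ} (c : Polynomial (MvPolynomial σ ℚ)) (hφ : DGen f g φ) :
      DGen f g (fun m => c.eval (MvPolynomial.C (m : ℚ)) * φ m)
  | pderiv {φ : ℕ → MvPolynomial σ ℚ} (i : σ) (hφ : DGen f g φ) :
      DGen f g (fun m => MvPolynomial.pderiv i (φ m))

variable {f g : MvPolynomial σ ℚ}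

theorem DGen.sum {ι : Type*} (s : Finset ι) {φ : ι → ℕ → MvPolynomial σ ℚ}
    (h : ∀ i ∈ s, DGen f g (φ i)) : DGen f g (fun m => ∑ i ∈ s, φ i m) := by
  classical
  induction s using Finset.induction_on with
  | empty => simpa using DGen.base.mul (0 : Polynomial (MvPolynomial σ ℚ)) (f := f) (g := g)
  | insert i s hi ih =>
    simp only [Finset.sum_insert hi]
    exact (h i (by simp)).add (ih fun j hj => h j (by simp [hj]))

theorem DGen.iterate {φ : ℕ → MvPolynomial σ ℚ} (h : DGen f g φ) (i : σ) (n : ℕ) :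
    DGen f g (fun m => (⇑(MvPolynomial.pderiv i))^[n] (φ m)) := by
  induction n with
  | zero => exact h
  | succ n ih => simpa only [Function.iterate_succ_apply'] using ih.pderiv i

theorem DGen.pdIter [Fintype σ] {φ : ℕ → MvPolynomial σ ℚ} (h : DGen f g φ) (α : σ → ℕ) :
    DGen f g (fun m => pdIter α (φ m)) := by
  unfold _root_.pdIter
  generalize (Finset.univ : Finset σ).toList = l
  induction l generalizing φ with
  | nil => exact h
  | cons j l ih => exact ih (h.iterate j (α j))

theorem DGen.exists_finsupp [Fintype σ] {φ : ℕ → MvPolynomial σ ℚ} (h : DGen f g φ) :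
    ∃ p : (σ → ℕ) →₀ Polynomial (MvPolynomial σ ℚ), ∀ m : ℕ,
      φ m = p.sum fun α c => c.eval (MvPolynomial.C (m : ℚ)) * _root_.pdIter α (g * f ^ (m + 1)) := by
  classical
  induction h with
  | base =>
    refine ⟨Finsupp.single 0 1, fun m => ?_⟩
    have h0 (l : List σ) (q : MvPolynomial σ ℚ) :
        l.foldl (fun q i => (⇑(MvPolynomial.pderiv i))^[(0 : σ → ℕ) i] q) q = q := by
      induction l with
      | nil => rfl
      | cons j l ih => simp
    rw [Finsupp.sum_single_index (by simp), _root_.pdIter, h0]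
    simp
  | add _ _ ih₁ ih₂ =>
    obtain ⟨p, hp⟩ := ih₁
    obtain ⟨q, hq⟩ := ih₂
    refine ⟨p + q, fun m => ?_⟩
    simp only [hp, hq]
    rw [Finsupp.sum_add_index' (by simp) (by simp [add_mul])]
  | mul c _ ih =>
    obtain ⟨p, hp⟩ := ih
    refine ⟨p.mapRange (fun d => c * d) (by simp), fun m => ?_⟩
    simp only [hp]
    rw [Finsupp.sum_mapRange_index (by simp), Finsupp.mul_sum]
    simp [mul_assoc]
  | pderiv i _ ih =>
    obtain ⟨p, hp⟩ := ih
    choose d hd using exists_eval_derivation (MvPolynomial.pderiv i)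
    refine ⟨p.sum fun α c => Finsupp.single α (d c) + Finsupp.single (α + Pi.single i 1) c,
      fun m => ?_⟩
    simp only [hp]
    rw [Finsupp.sum_sum_index (by simp) (by simp [add_mul]), Finsupp.sum, map_sum]
    refine Finset.sum_congr rfl fun α _ => ?_
    beta_reduce
    rw [Finsupp.sum_add_index' (by simp) (by simp [add_mul]),
      Finsupp.sum_single_index (by simp), Finsupp.sum_single_index (by simp),
      pdIter_add_single, MvPolynomial.pderiv_mul, hd]

theorem satisfiesBS_iff [Fintype σ] (b : Polynomial ℚ) :
    SatisfiesBS f g b ↔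
      DGen f g (fun m => MvPolynomial.C (Polynomial.eval (m : ℚ) b) * g * f ^ m) := by
  constructor
  · rintro ⟨A, p, h⟩
    simp only [h]
    refine DGen.sum A fun α _ => ?_
    simpa only [map_natCast] using (DGen.base.pdIter α).mul (p α)
  · intro h
    obtain ⟨p, hp⟩ := h.exists_finsupp
    exact ⟨p.support, p, fun m => by
      simpa only [map_natCast, Finsupp.sum] using hp m⟩

/-- Ideals `N n`, thought of as `N n • f^(r+1-n)`, that form a `D`-submodule of `ℚ[x, 1/f] f^r`
containing `g f^(r+1)`, contain the specialization at `s = r` of every element of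
`D[s] g f^(s+1)`. -/
theorem DGen.exists_eval_mem {N : ℕ → Ideal (MvPolynomial σ ℚ)} {r : ℚ}
    (hg : g ∈ N 0) (hf : ∀ n, ∀ q ∈ N n, f * q ∈ N (n + 1))
    (hD : ∀ n i, ∀ q ∈ N n, f * MvPolynomial.pderiv i q +
      MvPolynomial.C (r + 1 - n) * MvPolynomial.pderiv i f * q ∈ N (n + 1))
    {φ : ℕ → MvPolynomial σ ℚ} (h : DGen f g φ) :
    ∃ (n : ℕ) (Q : Polynomial (MvPolynomial σ ℚ)),
      (∀ m : ℕ, f ^ n * φ m = Q.eval (MvPolynomial.C (m : ℚ)) * f ^ (m + 1)) ∧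
        Q.eval (MvPolynomial.C r) ∈ N n := by
  have raise (k n : ℕ) (q : MvPolynomial σ ℚ) (hq : q ∈ N n) : f ^ k * q ∈ N (n + k) := by
    induction k with
    | zero => simpa using hq
    | succ k ih => simpa only [pow_succ', mul_assoc, add_assoc] using hf _ _ ih
  induction h with
  | base => exact ⟨0, Polynomial.C g, fun m => by simp, by simpa using hg⟩
  | add _ _ ih₁ ih₂ =>
    obtain ⟨n, P, hP, hP'⟩ := ih₁
    obtain ⟨k, Q, hQ, hQ'⟩ := ih₂
    refine ⟨n + k, Polynomial.C (f ^ k) * P + Polynomial.C (f ^ n) * Q, fun m => ?_, ?_⟩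
    · simp only [Polynomial.eval_add, Polynomial.eval_mul, Polynomial.eval_C]
      linear_combination f ^ k * hP m + f ^ n * hQ m
    · simp only [Polynomial.eval_add, Polynomial.eval_mul, Polynomial.eval_C]
      exact add_mem (raise _ _ _ hP') (add_comm n k ▸ raise _ _ _ hQ')
  | mul c _ ih =>
    obtain ⟨n, P, hP, hP'⟩ := ih
    refine ⟨n, c * P, fun m => ?_, ?_⟩
    · simp only [Polynomial.eval_mul]
      linear_combination c.eval (MvPolynomial.C (m : ℚ)) * hP m
    · simpa only [Polynomial.eval_mul] using Ideal.mul_mem_left _ _ hP'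
  | @pderiv φ i _ ih =>
    obtain ⟨n, P, hP, hP'⟩ := ih
    obtain ⟨d, hd⟩ := exists_eval_derivation (MvPolynomial.pderiv i) P
    have hd' (r : ℚ) : (Polynomial.C f * d + (Polynomial.X + 1 - (n : Polynomial _)) *
        Polynomial.C (MvPolynomial.pderiv i f) * P).eval (MvPolynomial.C r) =
        f * MvPolynomial.pderiv i (P.eval (MvPolynomial.C r)) +
          MvPolynomial.C (r + 1 - n) * MvPolynomial.pderiv i f * P.eval (MvPolynomial.C r) := by
      simp [hd]
    refine ⟨n + 1, _, fun m => ?_, (hd' r).symm ▸ hD n i _ hP'⟩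
    rw [hd']
    have h := congrArg (MvPolynomial.pderiv i) (hP m)
    have hn : f * ((n : MvPolynomial σ ℚ) * f ^ (n - 1)) = n * f ^ n := by
      cases n with
      | zero => simp
      | succ n => simp [pow_succ]; ring
    simp only [MvPolynomial.pderiv_mul, MvPolynomial.pderiv_pow, Nat.add_sub_cancel] at h
    have hc : (MvPolynomial.C ((m : ℚ) + 1 - n) : MvPolynomial σ ℚ) = m + 1 - n := by simp
    push_cast at h
    simp only [hc]
    linear_combination f * h - MvPolynomial.pderiv i f * φ m * hn
      - (n : MvPolynomial σ ℚ) * MvPolynomial.pderiv i f * hP m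

theorem eval_eq_zero_of_satisfiesBS [Fintype σ] {N : ℕ → Ideal (MvPolynomial σ ℚ)} {r : ℚ}
    (hf0 : f ≠ 0) (hg : g ∈ N 0) (hf : ∀ n, ∀ q ∈ N n, f * q ∈ N (n + 1))
    (hD : ∀ n i, ∀ q ∈ N n, f * MvPolynomial.pderiv i q +
      MvPolynomial.C (r + 1 - n) * MvPolynomial.pderiv i f * q ∈ N (n + 1))
    (hN : ∀ n, f ^ n * g ∉ N (n + 1)) {b : Polynomial ℚ} (hb : SatisfiesBS f g b) :
    b.eval r = 0 := by
  obtain ⟨n, Q, hQ, hQ'⟩ := ((satisfiesBS_iff b).1 hb).exists_eval_mem hg hf hD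
  have key : Polynomial.C (f ^ n * g) * b.map MvPolynomial.C = Polynomial.C f * Q := by
    refine Polynomial.eq_of_infinite_eval_eq _ _
      (Set.infinite_of_injective_forall_mem (f := fun m : ℕ => MvPolynomial.C (m : ℚ))
        ((MvPolynomial.C_injective σ ℚ).comp Nat.cast_injective) fun m => ?_)
    simp only [Set.mem_ofPred_eq, Polynomial.eval_mul, Polynomial.eval_C, ← C_eval_eq]
    refine mul_right_cancel₀ (pow_ne_zero m hf0) ?_
    linear_combination hQ m
  have h := congrArg (Polynomial.eval (MvPolynomial.C r)) key
  simp only [Polynomial.eval_mul, Polynomial.eval_C, ← C_eval_eq] at h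
  by_contra hbr
  refine hN n ?_
  have h2 := Ideal.mul_mem_left (N (n + 1)) (MvPolynomial.C (b.eval r)⁻¹) (hf n _ hQ')
  rw [← h, mul_left_comm, ← map_mul, inv_mul_cancel₀ hbr, map_one, mul_one] at h2
  exact h2

end General

section Functional

/-- The value `(-1)^j B(1/2 + i, γ + j) / B(1/2, γ)`. -/
noncomputable def betaRatio (γ : ℚ) (i j : ℕ) : ℚ :=
  (-1) ^ j * (∏ k ∈ Finset.range i, (1 / 2 + k : ℚ)) * (∏ k ∈ Finset.range j, (γ + k)) /
    ∏ k ∈ Finset.range (i + j), (1 / 2 + γ + k)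

variable {γ : ℚ}

theorem betaRatio_prod_ne_zero (hγ : 0 < γ) (n : ℕ) :
    ∏ k ∈ Finset.range n, (1 / 2 + γ + k) ≠ 0 :=
  Finset.prod_ne_zero_iff.2 fun k _ => by positivity

theorem betaRatio_succ_left (hγ : 0 < γ) (i j : ℕ) :
    (1 / 2 + γ + (i + j : ℕ)) * betaRatio γ (i + 1) j = (1 / 2 + i) * betaRatio γ i j := by
  have h := betaRatio_prod_ne_zero hγ (i + j)
  have h' : (1 / 2 + γ + (i + j : ℕ)) ≠ 0 := by positivity
  rw [betaRatio, betaRatio, add_right_comm i 1 j, Finset.prod_range_succ, Finset.prod_range_succ]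
  generalize ∏ k ∈ Finset.range (i + j), (1 / 2 + γ + k) = P at *
  generalize 1 / 2 + γ + (i + j : ℕ) = Q at *
  field_simp

theorem betaRatio_succ_right (hγ : 0 < γ) (i j : ℕ) :
    (1 / 2 + γ + (i + j : ℕ)) * betaRatio γ i (j + 1) = -(γ + j) * betaRatio γ i j := by
  have h := betaRatio_prod_ne_zero hγ (i + j)
  have h' : (1 / 2 + γ + (i + j : ℕ)) ≠ 0 := by positivity
  rw [betaRatio, betaRatio, ← add_assoc i j 1, Finset.prod_range_succ, Finset.prod_range_succ]
  generalize ∏ k ∈ Finset.range (i + j), (1 / 2 + γ + k) = P at *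
  generalize 1 / 2 + γ + (i + j : ℕ) = Q at *
  field_simp
  ring

theorem betaRatio_succ_sub_succ (hγ : 0 < γ) (i j : ℕ) :
    betaRatio γ (i + 1) j - betaRatio γ i (j + 1) = betaRatio γ i j := by
  have h' : (1 / 2 + γ + (i + j : ℕ)) ≠ 0 := by positivity
  refine mul_left_cancel₀ h' ?_
  rw [mul_sub, betaRatio_succ_left hγ, betaRatio_succ_right hγ]
  push_cast
  ring

/-- The integral of `u^a v^b (u²-v⁵)^(r+1-n)` over a twisted cycle of the Milnor fibre, normalised
to have rational values; it vanishes unless `a` is even, `b ≡ c` modulo 5, and the form has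
degree zero. -/
noncomputable def period (c n₀ n a b : ℕ) : ℚ :=
  if a % 2 = 0 ∧ b % 5 = c ∧ a / 2 + b / 5 + n₀ = n then
    betaRatio ((c + 1) / 5) (a / 2) (b / 5) else 0

theorem period_add_two_sub_add_five (c n₀ n a b : ℕ) :
    period c n₀ (n + 1) (a + 2) b - period c n₀ (n + 1) a (b + 5) = period c n₀ n a b := by
  have ha : (a + 2) / 2 = a / 2 + 1 := by omega
  have hb : (b + 5) / 5 = b / 5 + 1 := by omega
  have h := betaRatio_succ_sub_succ (γ := (c + 1) / 5) (by positivity) (a / 2) (b / 5)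
  simp only [period, ha, hb]
  by_cases hc : a % 2 = 0 ∧ b % 5 = c ∧ a / 2 + b / 5 + n₀ = n
  · rw [if_pos hc, if_pos (by omega), if_pos (by omega), h]
  · rw [if_neg hc, if_neg (by omega), if_neg (by omega), sub_zero]

theorem period_deriv_left (c n₀ n a b : ℕ) :
    a * period c n₀ n (a - 1) b +
      (n₀ - 1 / 2 - (c + 1) / 5 - n) * (2 * period c n₀ (n + 1) (a + 1) b) = 0 := by
  by_cases hc : a % 2 = 1 ∧ b % 5 = c ∧ a / 2 + b / 5 + n₀ = n
  · obtain ⟨ha, hb, hn⟩ := hc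
    have h1 : (a - 1) / 2 = a / 2 := by omega
    have h2 : (a + 1) / 2 = a / 2 + 1 := by omega
    have h3 : (a : ℚ) = 2 * (a / 2 : ℕ) + 1 := by norm_cast; omega
    have h := betaRatio_succ_left (γ := (c + 1) / 5) (by positivity) (a / 2) (b / 5)
    simp only [period, h1, h2]
    rw [if_pos (by omega), if_pos (by omega), h3, ← hn]
    push_cast at h ⊢
    linear_combination -2 * h
  · simp only [period]
    rw [if_neg (c := (a + 1) % 2 = 0 ∧ _) (by omega)]
    rcases Nat.eq_zero_or_pos a with rfl | ha
    · simp
    · rw [if_neg (by omega)]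
      simp

theorem period_deriv_right {c : ℕ} (hc4 : c < 4) (n₀ n a b : ℕ) :
    b * period c n₀ n a (b - 1) -
      (n₀ - 1 / 2 - (c + 1) / 5 - n) * (5 * period c n₀ (n + 1) a (b + 4)) = 0 := by
  by_cases hc : a % 2 = 0 ∧ b % 5 = c + 1 ∧ a / 2 + b / 5 + n₀ = n
  · obtain ⟨ha, hb, hn⟩ := hc
    have h1 : (b - 1) / 5 = b / 5 := by omega
    have h2 : (b + 4) / 5 = b / 5 + 1 := by omega
    have h3 : (b : ℚ) = 5 * (b / 5 : ℕ) + c + 1 := by norm_cast; omega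
    have h := betaRatio_succ_right (γ := (c + 1) / 5) (by positivity) (a / 2) (b / 5)
    simp only [period, h1, h2]
    rw [if_pos (by omega), if_pos (by omega), h3, ← hn]
    push_cast at h ⊢
    linear_combination 5 * h
  · simp only [period]
    rw [if_neg (c := a % 2 = 0 ∧ (b + 4) % 5 = c ∧ _) (by omega)]
    rcases Nat.eq_zero_or_pos b with rfl | hb
    · simp
    · rw [if_neg (by omega)]
      simp

/-- The linear extension of `period` to polynomials in `u, v`. -/
noncomputable def periodMap (c n₀ n : ℕ) : MvPolynomial (Fin 2) ℚ →ₗ[ℚ] ℚ :=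
  (MvPolynomial.basisMonomials (Fin 2) ℚ).constr ℚ fun e => period c n₀ n (e 0) (e 1)

theorem periodMap_monomial (c n₀ n : ℕ) (e : Fin 2 →₀ ℕ) (r : ℚ) :
    periodMap c n₀ n (MvPolynomial.monomial e r) = r * period c n₀ n (e 0) (e 1) := by
  have h : MvPolynomial.monomial e r = r • MvPolynomial.basisMonomials (Fin 2) ℚ e := by
    simp [MvPolynomial.smul_monomial]
  rw [h, map_smul, periodMap, Module.Basis.constr_basis, smul_eq_mul]

/-- The polynomial `u² - v⁵`. -/
noncomputable def cusp : MvPolynomial (Fin 2) ℚ :=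
  MvPolynomial.X 0 ^ 2 - MvPolynomial.X 1 ^ 5

theorem pderiv_zero_cusp : MvPolynomial.pderiv 0 cusp = 2 * MvPolynomial.X 0 := by
  simp [cusp, MvPolynomial.pderiv_X]

theorem pderiv_one_cusp : MvPolynomial.pderiv 1 cusp = -(5 * MvPolynomial.X 1 ^ 4) := by
  simp [cusp, MvPolynomial.pderiv_X]

theorem periodMap_X_pow_mul (c n₀ n : ℕ) (i : Fin 2) (k : ℕ) (e : Fin 2 →₀ ℕ) (r : ℚ) :
    periodMap c n₀ n (MvPolynomial.X i ^ k * MvPolynomial.monomial e r) =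
      r * period c n₀ n ((Finsupp.single i k + e) 0) ((Finsupp.single i k + e) 1) := by
  rw [MvPolynomial.X_pow_eq_monomial, MvPolynomial.monomial_mul, periodMap_monomial, one_mul]

theorem periodMap_cusp_mul (c n₀ n : ℕ) (q : MvPolynomial (Fin 2) ℚ) :
    periodMap c n₀ (n + 1) (cusp * q) = periodMap c n₀ n q := by
  induction q using MvPolynomial.induction_on' with
  | monomial e r =>
    rw [cusp, sub_mul, map_sub, periodMap_X_pow_mul, periodMap_X_pow_mul, periodMap_monomial,
      ← period_add_two_sub_add_five c n₀ n, mul_sub]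
    simp [add_comm]
  | add p q hp hq => rw [mul_add, map_add, map_add, hp, hq]

theorem periodMap_pderiv {c : ℕ} (hc : c < 4) (n₀ n : ℕ) (i : Fin 2)
    (q : MvPolynomial (Fin 2) ℚ) :
    periodMap c n₀ n (MvPolynomial.pderiv i q) + (n₀ - 1 / 2 - (c + 1) / 5 - n) *
      periodMap c n₀ (n + 1) (MvPolynomial.pderiv i cusp * q) = 0 := by
  induction q using MvPolynomial.induction_on' with
  | monomial e r =>
    fin_cases i
    · have h := period_deriv_left c n₀ n (e 0) (e 1)
      have h' : (2 * MvPolynomial.X 0 : MvPolynomial (Fin 2) ℚ) * MvPolynomial.monomial e r =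
          (2 : ℚ) • (MvPolynomial.X 0 ^ 1 * MvPolynomial.monomial e r) := by
        rw [MvPolynomial.smul_eq_C_mul, pow_one, mul_assoc]; rfl
      simp only [Fin.zero_eta, pderiv_zero_cusp, h', map_smul, periodMap_X_pow_mul,
        MvPolynomial.pderiv_monomial, periodMap_monomial, smul_eq_mul]
      simp [add_comm 1 (e 0)]
      linear_combination r * h
    · have h := period_deriv_right hc n₀ n (e 0) (e 1)
      have h' : (-(5 * MvPolynomial.X 1 ^ 4) : MvPolynomial (Fin 2) ℚ) *
          MvPolynomial.monomial e r =
          (-5 : ℚ) • (MvPolynomial.X 1 ^ 4 * MvPolynomial.monomial e r) := by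
        rw [MvPolynomial.smul_eq_C_mul, neg_mul, map_neg, neg_mul, mul_assoc]; rfl
      simp only [Fin.mk_one, pderiv_one_cusp, h', map_smul, periodMap_X_pow_mul,
        MvPolynomial.pderiv_monomial, periodMap_monomial, smul_eq_mul]
      simp [add_comm 4 (e 1)]
      linear_combination r * h
  | add p q hp hq =>
    rw [mul_add, map_add, map_add, map_add]
    linear_combination hp + hq

/-- The polynomials orthogonal to all of `ℚ[u, v]` for the pairing `(h, q) ↦ periodMap (h q)`. -/
noncomputable def periodKer (c n₀ n : ℕ) : Ideal (MvPolynomial (Fin 2) ℚ) where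
  carrier := {q | ∀ h, periodMap c n₀ n (h * q) = 0}
  add_mem' hp hq h := by rw [mul_add, map_add, hp, hq, add_zero]
  zero_mem' h := by rw [mul_zero, map_zero]
  smul_mem' r q hq h := by rw [smul_eq_mul, ← mul_assoc, hq]

theorem mem_periodKer {c n₀ n : ℕ} {q : MvPolynomial (Fin 2) ℚ} :
    q ∈ periodKer c n₀ n ↔ ∀ h, periodMap c n₀ n (h * q) = 0 := Iff.rfl

theorem cusp_mul_mem_periodKer {c n₀ n : ℕ} {q : MvPolynomial (Fin 2) ℚ}
    (hq : q ∈ periodKer c n₀ n) : cusp * q ∈ periodKer c n₀ (n + 1) := fun h => by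
  rw [mul_left_comm, periodMap_cusp_mul, hq]

theorem cusp_mul_pderiv_mem_periodKer {c n₀ n : ℕ} (hc : c < 4) (i : Fin 2)
    {q : MvPolynomial (Fin 2) ℚ} (hq : q ∈ periodKer c n₀ n) :
    cusp * MvPolynomial.pderiv i q + MvPolynomial.C (n₀ - 1 / 2 - (c + 1) / 5 - n : ℚ) *
      MvPolynomial.pderiv i cusp * q ∈ periodKer c n₀ (n + 1) := fun h => by
  have h1 := periodMap_pderiv hc n₀ n i (h * q)
  have h2 := hq (MvPolynomial.pderiv i h)
  rw [MvPolynomial.pderiv_mul, map_add, h2, zero_add] at h1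
  have h3 : h * (MvPolynomial.C (n₀ - 1 / 2 - (c + 1) / 5 - n : ℚ) *
      MvPolynomial.pderiv i cusp * q) =
      (n₀ - 1 / 2 - (c + 1) / 5 - n : ℚ) • (MvPolynomial.pderiv i cusp * (h * q)) := by
    rw [MvPolynomial.smul_eq_C_mul]
    ring
  rw [mul_add, mul_left_comm h, map_add, periodMap_cusp_mul, h3, map_smul, smul_eq_mul, h1]

end Functional

section Coordinates

/-- The substitution `x = (u + v) / 2`, `y = (u - v) / 2`. -/
noncomputable def toUV : MvPolynomial (Fin 2) ℚ →ₐ[ℚ] MvPolynomial (Fin 2) ℚ :=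
  MvPolynomial.aeval ![MvPolynomial.C (1 / 2) * (MvPolynomial.X 0 + MvPolynomial.X 1),
    MvPolynomial.C (1 / 2) * (MvPolynomial.X 0 - MvPolynomial.X 1)]

/-- The polynomial `(x + y)² - (x - y)⁵`. -/
noncomputable def tiltedCusp : MvPolynomial (Fin 2) ℚ :=
  (MvPolynomial.X 0 + MvPolynomial.X 1) ^ 2 - (MvPolynomial.X 0 - MvPolynomial.X 1) ^ 5

theorem two_mul_C_half : (2 : MvPolynomial (Fin 2) ℚ) * MvPolynomial.C (1 / 2) = 1 := by
  rw [← map_ofNat (MvPolynomial.C (σ := Fin 2) (R := ℚ)), ← map_mul]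
  norm_num

theorem toUV_X_zero : toUV (MvPolynomial.X 0) =
    MvPolynomial.C (1 / 2) * (MvPolynomial.X 0 + MvPolynomial.X 1) := by
  rw [toUV, MvPolynomial.aeval_X]; rfl

theorem toUV_X_one : toUV (MvPolynomial.X 1) =
    MvPolynomial.C (1 / 2) * (MvPolynomial.X 0 - MvPolynomial.X 1) := by
  rw [toUV, MvPolynomial.aeval_X]; rfl

theorem toUV_tiltedCusp : toUV tiltedCusp = cusp := by
  have h0 : toUV (MvPolynomial.X 0) + toUV (MvPolynomial.X 1) = MvPolynomial.X 0 := by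
    rw [toUV_X_zero, toUV_X_one]
    linear_combination MvPolynomial.X 0 * two_mul_C_half
  have h1 : toUV (MvPolynomial.X 0) - toUV (MvPolynomial.X 1) = MvPolynomial.X 1 := by
    rw [toUV_X_zero, toUV_X_one]
    linear_combination MvPolynomial.X 1 * two_mul_C_half
  rw [tiltedCusp, map_sub, map_pow, map_pow, map_add, map_sub, h0, h1, cusp]

theorem toUV_pderiv_zero (q : MvPolynomial (Fin 2) ℚ) :
    toUV (MvPolynomial.pderiv 0 q) =
      MvPolynomial.pderiv 0 (toUV q) + MvPolynomial.pderiv 1 (toUV q) := by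
  induction q using MvPolynomial.induction_on with
  | C a => simp [toUV]
  | add p q hp hq => simp only [map_add, hp, hq]; ring
  | mul_X p i hp =>
    fin_cases i
    · simp [-one_div, hp, toUV_X_zero, MvPolynomial.pderiv_X]
      linear_combination -toUV p * two_mul_C_half
    · simp [-one_div, hp, toUV_X_one, MvPolynomial.pderiv_X]
      ring

theorem toUV_pderiv_one (q : MvPolynomial (Fin 2) ℚ) :
    toUV (MvPolynomial.pderiv 1 q) =
      MvPolynomial.pderiv 0 (toUV q) - MvPolynomial.pderiv 1 (toUV q) := by
  induction q using MvPolynomial.induction_on with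
  | C a => simp [toUV]
  | add p q hp hq => simp only [map_add, hp, hq]; ring
  | mul_X p i hp =>
    fin_cases i
    · simp [-one_div, hp, toUV_X_zero, MvPolynomial.pderiv_X]
      ring
    · simp [-one_div, hp, toUV_X_one, MvPolynomial.pderiv_X]
      linear_combination -toUV p * two_mul_C_half

theorem tiltedCusp_eval_ne_zero :
    MvPolynomial.eval ![1, 1] tiltedCusp ≠ 0 := by
  norm_num [tiltedCusp]

theorem tiltedCusp_ne_zero : tiltedCusp ≠ 0 := fun h => by
  simpa [h] using tiltedCusp_eval_ne_zero

end Coordinates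

section LowerBound

theorem periodMap_monomial_mul_toUV_X_zero (c n₀ n : ℕ) (e : Fin 2 →₀ ℕ) (r : ℚ) :
    periodMap c n₀ n (MvPolynomial.monomial e r * toUV (MvPolynomial.X 0)) =
      1 / 2 * r * (period c n₀ n (e 0 + 1) (e 1) + period c n₀ n (e 0) (e 1 + 1)) := by
  have h : MvPolynomial.monomial e r * toUV (MvPolynomial.X 0) =
      (1 / 2 : ℚ) • (MvPolynomial.X 0 ^ 1 * MvPolynomial.monomial e r +
        MvPolynomial.X 1 ^ 1 * MvPolynomial.monomial e r) := by
    rw [toUV_X_zero, MvPolynomial.smul_eq_C_mul]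
    ring
  rw [h, map_smul, map_add, periodMap_X_pow_mul, periodMap_X_pow_mul, smul_eq_mul]
  simp [add_comm 1]
  ring

theorem toUV_X_zero_mem_periodKer {c n₀ : ℕ} (h : c = 0 ∨ n₀ = 1) :
    toUV (MvPolynomial.X 0) ∈ periodKer c n₀ 0 := fun q => by
  induction q using MvPolynomial.induction_on' with
  | monomial e r =>
    rw [periodMap_monomial_mul_toUV_X_zero, period, period, if_neg (by omega), if_neg (by omega),
      add_zero, mul_zero]
  | add p q hp hq => rw [add_mul, map_add, hp, hq, add_zero]

theorem periodMap_cusp_pow_mul (c n₀ n : ℕ) (q : MvPolynomial (Fin 2) ℚ) :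
    periodMap c n₀ (n + 1) (cusp ^ n * q) = periodMap c n₀ 1 q := by
  induction n with
  | zero => simp
  | succ n ih => rw [pow_succ', mul_assoc, periodMap_cusp_mul, ih]

theorem comap_periodKer_pderiv {c n₀ n : ℕ} (hc : c < 4) (i : Fin 2)
    {q : MvPolynomial (Fin 2) ℚ} (hq : q ∈ (periodKer c n₀ n).comap toUV) :
    tiltedCusp * MvPolynomial.pderiv i q + MvPolynomial.C (n₀ - 1 / 2 - (c + 1) / 5 - n : ℚ) *
      MvPolynomial.pderiv i tiltedCusp * q ∈ (periodKer c n₀ (n + 1)).comap toUV := by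
  rw [Ideal.mem_comap] at hq ⊢
  have h0 := cusp_mul_pderiv_mem_periodKer hc 0 hq
  have h1 := cusp_mul_pderiv_mem_periodKer hc 1 hq
  have hC (s : ℚ) : toUV (MvPolynomial.C s) = MvPolynomial.C s := toUV.commutes s
  simp only [map_add, map_mul toUV, hC, toUV_tiltedCusp]
  fin_cases i
  · simp only [Fin.zero_eta, toUV_pderiv_zero, toUV_tiltedCusp]
    rw [mul_add, mul_add, add_mul, add_add_add_comm]
    exact add_mem h0 h1
  · simp only [Fin.mk_one, toUV_pderiv_one, toUV_tiltedCusp]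
    rw [mul_sub, mul_sub, sub_mul, sub_add_sub_comm]
    exact sub_mem h0 h1

theorem eval_eq_zero_of_period_ne_zero {c n₀ : ℕ} (hc : c < 4) (h₀ : c = 0 ∨ n₀ = 1)
    (e : Fin 2 →₀ ℕ) (he : period c n₀ 1 (e 0 + 1) (e 1) + period c n₀ 1 (e 0) (e 1 + 1) ≠ 0)
    {b : Polynomial ℚ} (hb : SatisfiesBS tiltedCusp (MvPolynomial.X 0) b) :
    b.eval (n₀ - 3 / 2 - (c + 1) / 5 : ℚ) = 0 := by
  refine eval_eq_zero_of_satisfiesBS (N := fun n => (periodKer c n₀ n).comap toUV)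
    tiltedCusp_ne_zero (Ideal.mem_comap.2 (toUV_X_zero_mem_periodKer h₀)) (fun n q hq => ?_)
      (fun n i q hq => ?_)
    (fun n hn => ?_) hb
  · rw [Ideal.mem_comap, map_mul, toUV_tiltedCusp]
    exact cusp_mul_mem_periodKer hq
  · have hr : (n₀ - 3 / 2 - (c + 1) / 5 + 1 - n : ℚ) = n₀ - 1 / 2 - (c + 1) / 5 - n := by ring
    rw [hr]
    exact comap_periodKer_pderiv hc i hq
  · rw [Ideal.mem_comap, map_mul, map_pow, toUV_tiltedCusp] at hn
    have h := hn (MvPolynomial.monomial e 1)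
    rw [mul_left_comm, periodMap_cusp_pow_mul, periodMap_monomial_mul_toUV_X_zero] at h
    exact he (by linarith)

theorem eval_neg_one_eq_zero {b : Polynomial ℚ}
    (hb : SatisfiesBS tiltedCusp (MvPolynomial.X 0) b) : b.eval (-1) = 0 := by
  refine eval_eq_zero_of_satisfiesBS (N := fun n => Ideal.span {tiltedCusp ^ n})
    tiltedCusp_ne_zero (by simp) (fun n q hq => ?_) (fun n i q hq => ?_) (fun n hn => ?_) hb
  · rw [Ideal.mem_span_singleton] at hq ⊢
    rw [pow_succ']
    exact mul_dvd_mul_left _ hq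
  · rw [Ideal.mem_span_singleton] at hq ⊢
    obtain ⟨t, rfl⟩ := hq
    refine ⟨MvPolynomial.pderiv i t, ?_⟩
    have hc : (MvPolynomial.C (-1 + 1 - n : ℚ) : MvPolynomial (Fin 2) ℚ) = -n := by simp
    rw [MvPolynomial.pderiv_mul, MvPolynomial.pderiv_pow, hc]
    cases n with
    | zero => simp
    | succ n =>
      simp only [Nat.add_sub_cancel]
      ring
  · rw [Ideal.mem_span_singleton, pow_succ, mul_dvd_mul_iff_left
      (pow_ne_zero n tiltedCusp_ne_zero)] at hn
    obtain ⟨t, ht⟩ := hn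
    have h := congrArg (MvPolynomial.eval ![1, 0]) ht
    simp [tiltedCusp] at h

end LowerBound

section UpperBound

theorem DGen.of_nat_mul {σ : Type*} {f g : MvPolynomial σ ℚ} {φ : ℕ → MvPolynomial σ ℚ} {n : ℕ}
    (hn : n ≠ 0) (h : DGen f g (fun m => n * φ m)) : DGen f g φ := by
  have h' := h.mul (Polynomial.C (MvPolynomial.C (n : ℚ)⁻¹))
  have hc : (MvPolynomial.C (n : ℚ)⁻¹ : MvPolynomial σ ℚ) * n = 1 := by
    rw [← map_natCast (MvPolynomial.C (σ := σ) (R := ℚ)), ← map_mul,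
      inv_mul_cancel₀ (Nat.cast_ne_zero.2 hn), map_one]
  simpa only [Polynomial.eval_C, ← mul_assoc, hc, one_mul] using h'

theorem DGen.mul_const {σ : Type*} {f g : MvPolynomial σ ℚ} {φ : ℕ → MvPolynomial σ ℚ}
    (q : MvPolynomial σ ℚ) (h : DGen f g φ) : DGen f g (fun m => q * φ m) := by
  simpa only [Polynomial.eval_C] using h.mul (Polynomial.C q)

theorem DGen.sub {σ : Type*} {f g : MvPolynomial σ ℚ} {φ ψ : ℕ → MvPolynomial σ ℚ}
    (hφ : DGen f g φ) (hψ : DGen f g ψ) : DGen f g (fun m => φ m - ψ m) := by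
  simpa only [neg_one_mul, ← sub_eq_add_neg] using hφ.add (hψ.mul_const (-1))

/-- The derivation `2 ∂_u = ∂_x + ∂_y`. -/
noncomputable def derivU : Derivation ℚ (MvPolynomial (Fin 2) ℚ) (MvPolynomial (Fin 2) ℚ) :=
  MvPolynomial.pderiv 0 + MvPolynomial.pderiv 1

/-- The derivation `2 ∂_v = ∂_x - ∂_y`. -/
noncomputable def derivV : Derivation ℚ (MvPolynomial (Fin 2) ℚ) (MvPolynomial (Fin 2) ℚ) :=
  MvPolynomial.pderiv 0 - MvPolynomial.pderiv 1

/-- The linear form `u = x + y`. -/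
noncomputable def formU : MvPolynomial (Fin 2) ℚ := MvPolynomial.X 0 + MvPolynomial.X 1

/-- The linear form `v = x - y`. -/
noncomputable def formV : MvPolynomial (Fin 2) ℚ := MvPolynomial.X 0 - MvPolynomial.X 1

theorem two_mul_X_zero : 2 * MvPolynomial.X 0 = formU + formV := by
  rw [formU, formV]; ring

theorem tiltedCusp_eq : tiltedCusp = formU ^ 2 - formV ^ 5 := rfl

theorem derivU_formU : derivU formU = 2 := by
  simp [derivU, formU, MvPolynomial.pderiv_X]; norm_num

theorem derivU_formV : derivU formV = 0 := by
  simp [derivU, formV, MvPolynomial.pderiv_X]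

theorem derivV_formU : derivV formU = 0 := by
  simp [derivV, formU, MvPolynomial.pderiv_X]

theorem derivV_formV : derivV formV = 2 := by
  simp [derivV, formV, MvPolynomial.pderiv_X]; norm_num

theorem derivU_tiltedCusp : derivU tiltedCusp = 4 * formU := by
  simp [tiltedCusp_eq, Derivation.leibniz_pow, derivU_formU, derivU_formV]
  ring

theorem derivV_tiltedCusp : derivV tiltedCusp = -(10 * formV ^ 4) := by
  simp [tiltedCusp_eq, Derivation.leibniz_pow, derivV_formU, derivV_formV]
  ring

theorem derivU_tiltedCusp_pow (m : ℕ) :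
    derivU (tiltedCusp ^ (m + 1)) = (m + 1) * tiltedCusp ^ m * (4 * formU) := by
  simp [Derivation.leibniz_pow, derivU_tiltedCusp]
  ring

theorem derivV_tiltedCusp_pow (m : ℕ) :
    derivV (tiltedCusp ^ (m + 1)) = -((m + 1) * tiltedCusp ^ m * (10 * formV ^ 4)) := by
  simp [Derivation.leibniz_pow, derivV_tiltedCusp]
  ring

theorem euler_tiltedCusp_pow (m : ℕ) :
    5 * formU * derivU (tiltedCusp ^ m) + 2 * formV * derivV (tiltedCusp ^ m) =
      20 * m * tiltedCusp ^ m := by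
  cases m with
  | zero => simp
  | succ m =>
    rw [derivU_tiltedCusp_pow, derivV_tiltedCusp_pow, pow_succ, tiltedCusp_eq]
    push_cast
    ring

theorem DGen.derivU {φ : ℕ → MvPolynomial (Fin 2) ℚ} (h : DGen tiltedCusp (MvPolynomial.X 0) φ) :
    DGen tiltedCusp (MvPolynomial.X 0) (fun m => derivU (φ m)) :=
  (h.pderiv 0).add (h.pderiv 1)

theorem DGen.derivV {φ : ℕ → MvPolynomial (Fin 2) ℚ} (h : DGen tiltedCusp (MvPolynomial.X 0) φ) :
    DGen tiltedCusp (MvPolynomial.X 0) (fun m => derivV (φ m)) :=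
  (h.pderiv 0).sub (h.pderiv 1)

theorem dGen_formU_mul_pow_succ :
    DGen tiltedCusp (MvPolynomial.X 0) (fun m => formU * tiltedCusp ^ (m + 1)) := by
  have hG : DGen tiltedCusp (MvPolynomial.X 0) (fun m => MvPolynomial.X 0 * tiltedCusp ^ (m + 1)) :=
    DGen.base
  have h := (((hG.derivU.mul_const (5 * formU)).add (hG.derivV.mul_const (2 * formV))).mul_const
    2).sub (hG.mul (2 * (20 * Polynomial.X + 24)))
  refine DGen.of_nat_mul (n := 6) (by norm_num) ?_
  convert h using 2 with m
  have hU : derivU (MvPolynomial.X 0) = 1 := by simp [BernsteinSato.derivU, MvPolynomial.pderiv_X]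
  have hV : derivV (MvPolynomial.X 0) = 1 := by simp [BernsteinSato.derivV, MvPolynomial.pderiv_X]
  have hE := euler_tiltedCusp_pow (m + 1)
  simp [-Derivation.leibniz_pow, hU, hV]
  push_cast at hE
  linear_combination (-2 * MvPolynomial.X 0) * hE + 4 * tiltedCusp ^ (m + 1) * two_mul_X_zero

theorem dGen_formV_mul_pow_succ :
    DGen tiltedCusp (MvPolynomial.X 0) (fun m => formV * tiltedCusp ^ (m + 1)) := by
  have h := ((DGen.base (f := tiltedCusp) (g := MvPolynomial.X 0)).mul_const 2).sub
    dGen_formU_mul_pow_succ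
  convert h using 2 with m
  linear_combination -tiltedCusp ^ (m + 1) * two_mul_X_zero

theorem dGen_mul_pow_succ :
    DGen tiltedCusp (MvPolynomial.X 0)
      (fun m => (20 * m + 34 : MvPolynomial (Fin 2) ℚ) * tiltedCusp ^ (m + 1)) := by
  have h := (dGen_formU_mul_pow_succ.derivU.mul_const 5).add
    (dGen_formV_mul_pow_succ.derivV.mul_const 2)
  convert h using 2 with m
  have hE := euler_tiltedCusp_pow (m + 1)
  simp [-Derivation.leibniz_pow, derivU_formU, derivV_formV]
  push_cast at hE
  linear_combination -hE

/-- `c(s) h f^s` belongs to `D[s] x f^(s+1)`. -/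
def Kills (c : Polynomial ℚ) (h : MvPolynomial (Fin 2) ℚ) : Prop :=
  DGen tiltedCusp (MvPolynomial.X 0) (fun m => MvPolynomial.C (c.eval (m : ℚ)) * h * tiltedCusp ^ m)

theorem Kills.of_dvd {c d : Polynomial ℚ} {h : MvPolynomial (Fin 2) ℚ} (hc : Kills c h)
    (hd : c ∣ d) : Kills d h := by
  obtain ⟨e, rfl⟩ := hd
  have h' := DGen.mul (e.map MvPolynomial.C) hc
  simp only [← C_eval_eq] at h'
  unfold Kills
  convert h' using 2 with m
  rw [Polynomial.eval_mul, map_mul]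
  ring

theorem Kills.mul_left {c : Polynomial ℚ} {h : MvPolynomial (Fin 2) ℚ} (hc : Kills c h)
    (q : MvPolynomial (Fin 2) ℚ) : Kills c (q * h) := by
  have h' := hc.mul_const q
  unfold Kills
  convert h' using 2 with m
  ring

theorem C_eval_X_add_C (a : ℚ) (k n : ℕ) (hk : k * a = n) (m : ℕ) :
    (k : MvPolynomial (Fin 2) ℚ) *
      (MvPolynomial.C ((Polynomial.X + Polynomial.C a).eval (m : ℚ)) : MvPolynomial (Fin 2) ℚ) =
        k * m + n := by
  rw [← map_natCast (MvPolynomial.C (σ := Fin 2) (R := ℚ)), ← map_mul, Polynomial.eval_add,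
    Polynomial.eval_X, Polynomial.eval_C, mul_add, hk]
  simp

theorem Kills.euler {c : Polynomial ℚ} {k : ℕ} (hu : Kills c (formU * formV ^ k))
    (hv : Kills c (formV ^ (k + 1))) :
    Kills (c * (Polynomial.X + Polynomial.C ((7 + 2 * k) / 10 : ℚ))) (formV ^ k) := by
  refine DGen.of_nat_mul (n := 20) (by norm_num) ?_
  have h := (hu.derivU.mul_const 5).add (hv.derivV.mul_const 2)
  convert h using 2 with m
  have hE := euler_tiltedCusp_pow m
  have hd := C_eval_X_add_C ((7 + 2 * k) / 10) 20 (14 + 4 * k) (by push_cast; ring) m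
  have hC (D : Derivation ℚ (MvPolynomial (Fin 2) ℚ) (MvPolynomial (Fin 2) ℚ)) (r : ℚ) :
      D (MvPolynomial.C r) = 0 := D.map_algebraMap r
  have hVk : formV * BernsteinSato.derivV (formV ^ k) = 2 * k * formV ^ k := by
    cases k with
    | zero => simp
    | succ k => simp [Derivation.leibniz_pow, derivV_formV]; ring
  have hUk : BernsteinSato.derivU (formV ^ k) = 0 := by
    simp [Derivation.leibniz_pow, derivU_formV]
  rw [Polynomial.eval_mul, map_mul, pow_succ formV]
  push_cast at hd
  simp only [Derivation.leibniz, derivU_formU, derivV_formV, hC, hUk, smul_eq_mul]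
  push_cast
  linear_combination MvPolynomial.C (c.eval (m : ℚ)) * formV ^ k * (tiltedCusp ^ m * hd - hE) -
    2 * MvPolynomial.C (c.eval (m : ℚ)) * tiltedCusp ^ m * hVk

theorem kills_formU_mul_formV :
    Kills (Polynomial.X + Polynomial.C 1) (formU * formV) := by
  refine DGen.of_nat_mul (n := 4) (by norm_num) ?_
  convert dGen_formV_mul_pow_succ.derivU using 2 with m
  simp [-Derivation.leibniz_pow, derivU_formV, derivU_tiltedCusp_pow]
  ring

theorem derivation_natCast_linear (D : Derivation ℚ (MvPolynomial (Fin 2) ℚ)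
    (MvPolynomial (Fin 2) ℚ)) (m : ℕ) : D (20 * m + 34) = 0 := by
  exact_mod_cast D.map_natCast (20 * m + 34)

theorem kills_formU :
    Kills ((Polynomial.X + Polynomial.C 1) * (Polynomial.X + Polynomial.C (17 / 10))) formU := by
  refine DGen.of_nat_mul (n := 80) (by norm_num) ?_
  convert dGen_mul_pow_succ.derivU using 2 with m
  have hd := C_eval_X_add_C (17 / 10) 20 34 (by norm_num) m
  have h1 := C_eval_X_add_C 1 1 1 (by norm_num) m
  push_cast at hd h1
  rw [Derivation.leibniz, derivation_natCast_linear, derivU_tiltedCusp_pow, Polynomial.eval_mul,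
    map_mul, smul_eq_mul, smul_zero, add_zero, ← hd]
  push_cast
  linear_combination (80 *
    MvPolynomial.C ((Polynomial.X + Polynomial.C (17 / 10 : ℚ)).eval (m : ℚ)) * formU * tiltedCusp ^ m)
      * h1

theorem kills_formV_pow_four :
    Kills ((Polynomial.X + Polynomial.C 1) * (Polynomial.X + Polynomial.C (17 / 10)))
      (formV ^ 4) := by
  refine DGen.of_nat_mul (n := 200) (by norm_num) ?_
  convert dGen_mul_pow_succ.derivV.mul_const (-1) using 2 with m
  have hd := C_eval_X_add_C (17 / 10) 20 34 (by norm_num) m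
  have h1 := C_eval_X_add_C 1 1 1 (by norm_num) m
  push_cast at hd h1
  rw [Derivation.leibniz, derivation_natCast_linear, derivV_tiltedCusp_pow, Polynomial.eval_mul,
    map_mul, smul_eq_mul, smul_zero, add_zero, ← hd]
  push_cast
  linear_combination (200 *
    MvPolynomial.C ((Polynomial.X + Polynomial.C (17 / 10 : ℚ)).eval (m : ℚ)) * formV ^ 4 * tiltedCusp ^ m)
      * h1

theorem kills_formV :
    Kills ((Polynomial.X + Polynomial.C (9 / 10 : ℚ)) * (Polynomial.X + Polynomial.C (1 : ℚ)) *
      (Polynomial.X + Polynomial.C (11 / 10 : ℚ)) * (Polynomial.X + Polynomial.C (13 / 10 : ℚ)) *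
      (Polynomial.X + Polynomial.C (17 / 10 : ℚ))) formV := by
  have huv (k : ℕ) {c : Polynomial ℚ} (hc : Polynomial.X + Polynomial.C 1 ∣ c) :
      Kills c (formU * formV ^ (k + 1)) := by
    have h := (kills_formU_mul_formV.of_dvd hc).mul_left (formV ^ k)
    rwa [show formV ^ k * (formU * formV) = formU * formV ^ (k + 1) by ring] at h
  have h4 := kills_formV_pow_four
  have h3 := (huv 2 (dvd_mul_right _ _)).euler h4
  have h2 := (huv 1 ((dvd_mul_right _ _).mul_right _)).euler h3
  have h1 := (huv 0 (((dvd_mul_right _ _).mul_right _).mul_right _)).euler h2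
  rw [zero_add, pow_one] at h1
  refine h1.of_dvd (dvd_of_eq ?_)
  norm_num
  ring

theorem satisfiesBS_of_dvd {b : Polynomial ℚ}
    (hb : (Polynomial.X + Polynomial.C (9 / 10 : ℚ)) * (Polynomial.X + Polynomial.C (1 : ℚ)) *
      (Polynomial.X + Polynomial.C (11 / 10 : ℚ)) * (Polynomial.X + Polynomial.C (13 / 10 : ℚ)) *
      (Polynomial.X + Polynomial.C (17 / 10 : ℚ)) ∣ b) :
    SatisfiesBS tiltedCusp (MvPolynomial.X 0) b := by
  have hv := kills_formV.of_dvd hb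
  have hu : Kills b formU := kills_formU.of_dvd (dvd_trans ⟨(Polynomial.X + Polynomial.C (9 / 10)) *
    (Polynomial.X + Polynomial.C (11 / 10)) * (Polynomial.X + Polynomial.C (13 / 10)), by ring⟩ hb)
  rw [satisfiesBS_iff]
  refine DGen.of_nat_mul (n := 2) (by norm_num) ?_
  convert hu.add hv using 2 with m
  push_cast
  linear_combination MvPolynomial.C (b.eval (m : ℚ)) * tiltedCusp ^ m * two_mul_X_zero

end UpperBound

theorem dvd_of_eval_eq_zero {b : Polynomial ℚ} (h₁ : b.eval (-(9 / 10)) = 0)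
    (h₂ : b.eval (-1) = 0) (h₃ : b.eval (-(11 / 10)) = 0) (h₄ : b.eval (-(13 / 10)) = 0)
    (h₅ : b.eval (-(17 / 10)) = 0) :
    (Polynomial.X + Polynomial.C (9 / 10 : ℚ)) * (Polynomial.X + Polynomial.C (1 : ℚ)) *
      (Polynomial.X + Polynomial.C (11 / 10 : ℚ)) * (Polynomial.X + Polynomial.C (13 / 10 : ℚ)) *
      (Polynomial.X + Polynomial.C (17 / 10 : ℚ)) ∣ b := by
  have hdvd {a : ℚ} (h : b.eval (-a) = 0) : Polynomial.X + Polynomial.C a ∣ b := by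
    simpa using Polynomial.dvd_iff_isRoot.2 h
  have hcop {a a' : ℚ} (h : a' - a ≠ 0) :
      IsCoprime (Polynomial.X + Polynomial.C a) (Polynomial.X + Polynomial.C a') := by
    have h' := Polynomial.isCoprime_X_sub_C_of_isUnit_sub (R := ℚ) (a := -a) (b := -a')
      (by simpa [add_comm, sub_eq_add_neg] using h)
    simpa using h'
  have h₁₂ := (hcop (by norm_num)).mul_dvd (hdvd h₁) (hdvd h₂)
  have h₁₃ := ((hcop (by norm_num)).mul_left (hcop (by norm_num))).mul_dvd h₁₂ (hdvd h₃)
  have h₁₄ := (((hcop (by norm_num)).mul_left (hcop (by norm_num))).mul_left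
    (hcop (by norm_num))).mul_dvd h₁₃ (hdvd h₄)
  exact ((((hcop (by norm_num)).mul_left (hcop (by norm_num))).mul_left
    (hcop (by norm_num))).mul_left (hcop (by norm_num))).mul_dvd h₁₄ (hdvd h₅)

end BernsteinSato

open BernsteinSato

theorem bernsteinSato_stmt_12 :
    ∀ b : Polynomial ℚ,
      SatisfiesBS ((X 0 + X 1) ^ 2 - (X 0 - X 1) ^ 5 : MvPolynomial (Fin 2) ℚ)
          (X 0) b ↔
        (Polynomial.X + Polynomial.C (9 / 10 : ℚ)) *
            (Polynomial.X + Polynomial.C (1 : ℚ)) *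
            (Polynomial.X + Polynomial.C (11 / 10 : ℚ)) *
            (Polynomial.X + Polynomial.C (13 / 10 : ℚ)) *
            (Polynomial.X + Polynomial.C (17 / 10 : ℚ)) ∣ b := by
  refine fun b => ⟨fun hb => ?_, satisfiesBS_of_dvd⟩
  refine dvd_of_eval_eq_zero ?_ (eval_neg_one_eq_zero hb) ?_ ?_ ?_
  · have h := eval_eq_zero_of_period_ne_zero (c := 1) (n₀ := 1) (by norm_num) (by norm_num) 0
      (by norm_num [period, betaRatio]) hb
    norm_num at h ⊢
    exact h
  · have h := eval_eq_zero_of_period_ne_zero (c := 2) (n₀ := 1) (by norm_num) (by norm_num)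
      (Finsupp.single 1 1) (by norm_num [period, betaRatio]) hb
    norm_num at h ⊢
    exact h
  · have h := eval_eq_zero_of_period_ne_zero (c := 3) (n₀ := 1) (by norm_num) (by norm_num)
      (Finsupp.single 1 2) (by norm_num [period, betaRatio]) hb
    norm_num at h ⊢
    exact h
  · have h := eval_eq_zero_of_period_ne_zero (c := 0) (n₀ := 0) (by norm_num) (by norm_num)
      (Finsupp.single 0 1) (by norm_num [period, betaRatio]) hb
    norm_num at h ⊢
    exact h
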